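/- For every real number x, the series ∑_{n≥1} (μ(n)·B̄_1(nx)/n)² converges absolutely and ∑_{n≥1} (μ(n)·B̄_1(nx)/n)² = (1/12)·ζ(2)/ζ(4) + (1/π²) · ∑_{n≥1} 2^{ω(n)}·cos(2πnx)/n², where the series on the right converges absolutely. -/

import Mathlib

/-- The periodized Bernoulli polynomial `B̄ₘ(x) = Bₘ({x})`. -/
noncomputable def bernPer (m : ℕ) (x : ℝ) : ℝ :=
  ((Polynomial.bernoulli m).map (algebraMap ℚ ℝ)).eval (Int.fract x)

lemma moebius_sq_mul_of_coprime {m n : ℕ} (h : m.Coprime n) :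
    (ArithmeticFunction.moebius (m * n) : ℝ) ^ 2
      = (ArithmeticFunction.moebius m : ℝ) ^ 2 * (ArithmeticFunction.moebius n : ℝ) ^ 2 := by
  rw [ArithmeticFunction.isMultiplicative_moebius.map_mul_of_coprime h]
  push_cast
  ring

lemma moebius_sq_le_one (n : ℕ) : (ArithmeticFunction.moebius n : ℝ) ^ 2 ≤ 1 := by
  rw [sq_le_one_iff_abs_le_one]
  exact_mod_cast ArithmeticFunction.abs_moebius_le_one

/-- The number of squarefree divisors of `n` is `2 ^ ω(n)`. -/
lemma sum_divisors_moebius_sq {n : ℕ} (hn : n ≠ 0) :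
    ∑ d ∈ n.divisors, (ArithmeticFunction.moebius d : ℝ) ^ 2 = 2 ^ n.primeFactors.card := by
  have h : ∀ d : ℕ, (ArithmeticFunction.moebius d : ℝ) ^ 2 = if Squarefree d then 1 else 0 := by
    intro d
    exact_mod_cast ArithmeticFunction.moebius_sq (n := d)
  simp_rw [h]
  rw [← Finset.sum_filter, Nat.sum_divisors_filter_squarefree hn]
  simp [Nat.factors_eq]

/-- `∑ μ(n)² / n² = ζ(2) / ζ(4)`. -/
lemma tsum_moebius_sq_div_sq :
    (((∑' n : ℕ, (ArithmeticFunction.moebius n : ℝ) ^ 2 / (n : ℝ) ^ 2 : ℝ)) : ℂ)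
      = riemannZeta 2 / riemannZeta 4 := by
  set f : ℕ → ℂ := fun n => (ArithmeticFunction.moebius n : ℂ) ^ 2 / (n : ℂ) ^ 2 with hf
  have hsum : Summable (fun n => ‖f n‖) := by
    refine Summable.of_nonneg_of_le (fun _ => norm_nonneg _) (fun n => ?_)
      (Real.summable_one_div_nat_pow.mpr one_lt_two)
    have h : ‖(ArithmeticFunction.moebius n : ℂ) ^ 2‖ ≤ 1 := by
      have := moebius_sq_le_one n
      rwa [norm_pow, Complex.norm_intCast, sq_abs]
    simp only [hf, norm_div, norm_pow, Complex.norm_natCast] at h ⊢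
    gcongr
  have hprod := EulerProduct.eulerProduct_hasProd (f := f) (by simp [hf])
    (fun {m n} h => by
      have := moebius_sq_mul_of_coprime h
      have h2 : (ArithmeticFunction.moebius (m * n) : ℂ) ^ 2
        = (ArithmeticFunction.moebius m : ℂ) ^ 2 * (ArithmeticFunction.moebius n : ℂ) ^ 2 := by
        exact_mod_cast this
      simp only [hf, h2, Nat.cast_mul]
      rw [mul_pow, mul_div_mul_comm]) hsum (by simp [hf])
  have hlocal (p : Nat.Primes) : ∑' e, f ((p : ℕ) ^ e) = 1 + ((p : ℂ) ^ 2)⁻¹ := by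
    rw [tsum_eq_sum (s := Finset.range 2)]
    · simp [hf, Finset.sum_range_succ, ArithmeticFunction.moebius_apply_prime p.2]
    · intro e he
      have he : 1 < e := by simpa using he
      simp [hf, ArithmeticFunction.moebius_apply_prime_pow p.2 (by omega : e ≠ 0), he.ne']
  have h2 := riemannZeta_eulerProduct_hasProd (s := 2) (by norm_num)
  have h4 := riemannZeta_eulerProduct_hasProd (s := 4) (by norm_num)
  have key : (∑' n, f n) * riemannZeta 4 = riemannZeta 2 := by
    refine (hprod.mul h4).unique ?_
    convert h2 using 2 with p
    have hp : (1 : ℝ) < (p : ℕ) := by exact_mod_cast p.2.one_lt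
    have e2 : (p : ℂ) ^ (-2 : ℂ) = ((p : ℂ) ^ 2)⁻¹ := by
      rw [Complex.cpow_neg]; norm_cast
    have e4 : (p : ℂ) ^ (-4 : ℂ) = ((p : ℂ) ^ 2)⁻¹ ^ 2 := by
      rw [Complex.cpow_neg, ← inv_pow, ← pow_mul, inv_pow]; norm_cast
    have hlt : ‖((p : ℂ) ^ 2)⁻¹‖ < 1 := by
      rw [norm_inv, norm_pow, Complex.norm_natCast]
      exact inv_lt_one_of_one_lt₀ (one_lt_pow₀ hp two_ne_zero)
    rw [hlocal, e2, e4]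
    generalize ((p : ℂ) ^ 2)⁻¹ = t at hlt
    have h1 : 1 - t ≠ 0 := by
      intro h
      rw [← sub_eq_zero.mp h] at hlt
      simp at hlt
    have h1' : 1 + t ≠ 0 := by
      intro h
      rw [← neg_eq_of_add_eq_zero_right h] at hlt
      simp at hlt
    rw [show 1 - t ^ 2 = (1 - t) * (1 + t) by ring]
    field_simp
  rw [eq_div_iff (riemannZeta_ne_zero_of_one_lt_re (by norm_num)), ← key]
  congr 1
  rw [Complex.ofReal_tsum]
  simp [hf]

/-- Grouping a double series over positive integers by the product of the indices. -/
lemma hasSum_sum_divisorsAntidiagonal {F : ℕ → ℕ → ℝ}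
    (hF : Summable fun p : ℕ+ × ℕ+ => F p.1 p.2) :
    HasSum (fun n : ℕ+ => ∑ p ∈ (n : ℕ).divisorsAntidiagonal, F p.1 p.2)
      (∑' a : ℕ+, ∑' b : ℕ+, F a b) := by
  rw [← hF.tsum_prod]
  refine HasSum.sigma (sigmaAntidiagonalEquivProd.hasSum_iff.mpr hF.hasSum) fun n => ?_
  rw [← Finset.sum_attach]
  exact hasSum_fintype _

lemma summable_one_div_pnat_sq : Summable fun n : ℕ+ => 1 / (n : ℝ) ^ 2 :=
  summable_pnat_iff_summable_nat.mpr (Real.summable_one_div_nat_pow.mpr one_lt_two)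

/-- The Dirichlet convolution of `μ(n)² / n²` and `u(mn) / m²` for bounded `u`. -/
lemma hasSum_two_pow_card_primeFactors_mul {u : ℕ → ℝ} (hu : ∀ n, |u n| ≤ 1) :
    HasSum (fun n : ℕ+ => (2 : ℝ) ^ (n : ℕ).primeFactors.card * u n / (n : ℝ) ^ 2)
      (∑' a : ℕ+, ∑' b : ℕ+,
        (ArithmeticFunction.moebius a : ℝ) ^ 2 * u (a * b) / ((a : ℝ) * b) ^ 2) := by
  have hF : Summable fun p : ℕ+ × ℕ+ =>
      (ArithmeticFunction.moebius p.1 : ℝ) ^ 2 * u (p.1 * p.2) / ((p.1 : ℝ) * p.2) ^ 2 := by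
    refine Summable.of_norm_bounded (summable_one_div_pnat_sq.mul_of_nonneg
      summable_one_div_pnat_sq (fun _ => by positivity) fun _ => by positivity) fun p => ?_
    rw [Real.norm_eq_abs, abs_div, abs_mul, abs_sq, abs_sq, div_mul_div_comm, ← mul_pow]
    gcongr
    exacts [moebius_sq_le_one _, hu _]
  refine (hasSum_sum_divisorsAntidiagonal
    (F := fun a b => (ArithmeticFunction.moebius a : ℝ) ^ 2 * u (a * b) / ((a : ℝ) * b) ^ 2)
    hF).congr_fun fun n => ?_
  rw [← sum_divisors_moebius_sq n.ne_zero, ← Nat.sum_divisorsAntidiagonal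
    (fun d _ => (ArithmeticFunction.moebius d : ℝ) ^ 2), Finset.sum_mul, Finset.sum_div]
  refine Finset.sum_congr rfl fun p hp => ?_
  rw [← Nat.cast_mul, (Nat.mem_divisorsAntidiagonal.mp hp).1]

lemma bernPer_one (x : ℝ) : bernPer 1 x = Int.fract x - 1 / 2 :=
  bernoulliFun_one _

lemma bernPer_two (x : ℝ) : bernPer 2 x = Int.fract x ^ 2 - Int.fract x + 6⁻¹ :=
  bernoulliFun_two _

lemma bernPer_one_sq (x : ℝ) : bernPer 1 x ^ 2 = 1 / 12 + bernPer 2 x := by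
  rw [bernPer_one, bernPer_two]
  ring

lemma abs_bernPer_one_le (x : ℝ) : |bernPer 1 x| ≤ 1 / 2 := by
  rw [bernPer_one, abs_le]
  constructor <;> linarith [Int.fract_nonneg x, Int.fract_lt_one x]

/-- The Fourier expansion of the periodized second Bernoulli polynomial. -/
lemma hasSum_cos_div_sq (y : ℝ) :
    HasSum (fun n : ℕ => Real.cos (2 * Real.pi * n * y) / (n : ℝ) ^ 2)
      (Real.pi ^ 2 * bernPer 2 y) := by
  convert hasSum_one_div_nat_pow_mul_cos one_ne_zero
    ⟨Int.fract_nonneg y, (Int.fract_lt_one y).le⟩ using 2 with n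
  · rw [one_div_mul_eq_div, mul_one]
    congr 1
    rw [← Real.cos_sub_int_mul_two_pi _ (n * ⌊y⌋), Int.fract]
    push_cast
    ring_nf
  · norm_num [Nat.factorial]
    ring
  · rfl

theorem stmt7 (x : ℝ) :
    (Summable fun n : ℕ =>
      |((ArithmeticFunction.moebius (n + 1) : ℝ) * bernPer 1 ((n + 1) * x) / (n + 1)) ^ 2|) ∧
    (Summable fun n : ℕ =>
      |(2 : ℝ) ^ (n + 1).primeFactors.card * Real.cos (2 * Real.pi * (n + 1) * x) / (n + 1) ^ 2|) ∧
    ((∑' n : ℕ,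
        ((ArithmeticFunction.moebius (n + 1) : ℝ) * bernPer 1 ((n + 1) * x) / (n + 1)) ^ 2 : ℝ) : ℂ)
      = 1 / 12 * riemannZeta 2 / riemannZeta 4 +
        ((1 / Real.pi ^ 2 * ∑' n : ℕ,
          (2 : ℝ) ^ (n + 1).primeFactors.card * Real.cos (2 * Real.pi * (n + 1) * x) / (n + 1) ^ 2
          : ℝ) : ℂ) := by
  set f : ℕ → ℝ := fun n =>
    ((ArithmeticFunction.moebius n : ℝ) * bernPer 1 (n * x) / n) ^ 2 with hf
  set g : ℕ → ℝ := fun n =>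
    (2 : ℝ) ^ n.primeFactors.card * Real.cos (2 * Real.pi * n * x) / (n : ℝ) ^ 2 with hg
  set q : ℕ → ℝ := fun n => (ArithmeticFunction.moebius n : ℝ) ^ 2 / (n : ℝ) ^ 2 with hq
  have hq_summable : Summable fun n : ℕ+ => q n := by
    refine summable_one_div_pnat_sq.of_nonneg_of_le (fun _ => by positivity) fun n => ?_
    simp only [hq]
    gcongr
    exact moebius_sq_le_one _
  have hf_eq (n : ℕ) : f n = 1 / 12 * q n + q n * bernPer 2 (n * x) := by
    simp only [hf, hq]
    rw [div_pow, mul_pow, bernPer_one_sq]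
    ring
  have hf_summable : Summable fun n : ℕ+ => f n := by
    refine hq_summable.of_nonneg_of_le (fun _ => by positivity) fun n => ?_
    simp only [hf, hq]
    rw [div_pow, mul_pow]
    gcongr
    refine mul_le_of_le_one_right (sq_nonneg _) ?_
    rw [sq_le_one_iff_abs_le_one]
    linarith [abs_bernPer_one_le (n * x)]
  have hg_sum : HasSum (fun n : ℕ+ => g n)
      (∑' a : ℕ+, Real.pi ^ 2 * (q a * bernPer 2 (a * x))) := by
    convert hasSum_two_pow_card_primeFactors_mul
      (u := fun n => Real.cos (2 * Real.pi * n * x)) (fun _ => Real.abs_cos_le_one _) using 1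
    refine tsum_congr fun a => ?_
    have h := (hasSum_cos_div_sq (a * x)).tsum_eq
    rw [← tsum_pnat_eq_tsum_of_eq_zero (by simp)] at h
    rw [show Real.pi ^ 2 * (q a * bernPer 2 (a * x))
      = q a * (Real.pi ^ 2 * bernPer 2 (a * x)) by ring, ← h, ← tsum_mul_left]
    refine tsum_congr fun b => ?_
    simp only [hq]
    push_cast
    rw [mul_pow, div_mul_div_comm]
    ring_nf
  have hmain : ∑' n : ℕ+, f n = 1 / 12 * ∑' n : ℕ+, q n + 1 / Real.pi ^ 2 * ∑' n : ℕ+, g n := by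
    have hr : Summable fun n : ℕ+ => q n * bernPer 2 (n * x) := by
      refine (hf_summable.sub (hq_summable.mul_left (1 / 12))).congr fun n => ?_
      rw [hf_eq]
      ring
    rw [hg_sum.tsum_eq, tsum_mul_left, ← tsum_mul_left, ← mul_assoc, one_div_mul_cancel
      (by positivity), one_mul, ← (hq_summable.mul_left _).tsum_add hr]
    exact tsum_congr fun n => hf_eq n
  have hq_zero : q 0 = 0 := by simp [hq]
  refine ⟨?_, ?_, ?_⟩
  · have := (summable_pnat_iff_summable_succ (f := fun n => |f n|)).mp hf_summable.abs
    simpa [hf] using this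
  · have := (summable_pnat_iff_summable_succ (f := fun n => |g n|)).mp hg_sum.summable.abs
    simpa [hg] using this
  · have h1 := tsum_pnat_eq_tsum_succ (f := f)
    have h2 := tsum_pnat_eq_tsum_succ (f := g)
    rw [h1, h2] at hmain
    simp only [hf, hg, Nat.cast_add, Nat.cast_one] at hmain
    rw [hmain, mul_div_assoc, ← tsum_moebius_sq_div_sq, tsum_pnat_eq_tsum_of_eq_zero hq_zero]
    simp only [hq]
    push_cast
    rfl
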